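/- arXiv:2401.02609 — 2 statements merged into one kernel-verified Lean document; each statement's English description precedes it below -/
import Mathlib

section
/- Let P and Q be probability measures on a measurable space 𝒴 with Q ≪ P, with density r = dQ/dP satisfying 0 < r(y) ≤ ω for P-a.e. y, and assume d₂(P‖Q) = E_{Y∼P}[1/r(Y)] and d₃(P‖Q) = E_{Y∼P}[1/r(Y)²] are finite. Let Y_1,…,Y_N be i.i.d. with law P and λ_i = r(Y_i)/Σ_{j=1}^N r(Y_j). Then E[ Σ_{i=1}^N λ_i log₂(N λ_i) ] ≤ D(Q‖P) + (6(ω−1)log₂ ω)/N + α/N, where D(Q‖P) = E_{Y∼P}[r(Y) log₂ r(Y)] and α = 2(ω−1) + 2√(ω−1)·(d₃(P‖Q) − d₂(P‖Q)²)^{1/2} + 4ω·d₂(P‖Q). -/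
open MeasureTheory ProbabilityTheory

section Pointwise

variable {ι : Type*} [Fintype ι] {x : ι → ℝ}

/-- The relative entropy of self-normalized weights to the uniform distribution is nonnegative. -/
lemma sum_weight_mul_log_nonneg [Nonempty ι] (hx : ∀ i, 0 < x i) :
    0 ≤ ∑ i, (x i / ∑ j, x j) * Real.log (Fintype.card ι * (x i / ∑ j, x j)) := by
  have hS : 0 < ∑ j, x j := Finset.sum_pos (fun i _ => hx i) Finset.univ_nonempty
  have hn : (0 : ℝ) < Fintype.card ι := by exact_mod_cast Fintype.card_pos
  have hterm : ∀ i, x i / ∑ j, x j - 1 / (Fintype.card ι : ℝ) ≤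
      (x i / ∑ j, x j) * Real.log (Fintype.card ι * (x i / ∑ j, x j)) := fun i => by
    have hw : 0 < x i / ∑ j, x j := div_pos (hx i) hS
    have h := mul_le_mul_of_nonneg_left
      (Real.one_sub_inv_le_log_of_pos (mul_pos hn hw)) hw.le
    refine le_trans (le_of_eq ?_) h
    have := (hx i).ne'
    field_simp
  refine le_trans (le_of_eq ?_) (Finset.sum_le_sum fun i _ => hterm i)
  rw [Finset.sum_sub_distrib, ← Finset.sum_div, div_self hS.ne']
  simp [hn.ne']

/-- The reciprocal of an arithmetic mean is at most the mean of the reciprocals. -/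
lemma inv_mean_le_mean_inv [Nonempty ι] (hx : ∀ i, 0 < x i) :
    ((∑ i, x i) / Fintype.card ι)⁻¹ ≤ (∑ i, (x i)⁻¹) / Fintype.card ι := by
  have hS : 0 < ∑ j, x j := Finset.sum_pos (fun i _ => hx i) Finset.univ_nonempty
  have hn : (0 : ℝ) < Fintype.card ι := by exact_mod_cast Fintype.card_pos
  have h := Finset.sum_sq_le_sum_mul_sum_of_sq_le_mul (r := fun _ => (1 : ℝ)) (f := x)
    (g := fun i => (x i)⁻¹) Finset.univ (fun i _ => (hx i).le) (fun i _ => (inv_pos.2 (hx i)).le)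
    (fun i _ => by rw [mul_inv_cancel₀ (hx i).ne', one_pow])
  simp only [Finset.sum_const, Finset.card_univ, nsmul_eq_mul, mul_one] at h
  rw [inv_div, div_le_div_iff₀ hS hn]
  nlinarith

/-- Second-order bound on the relative entropy of self-normalized weights to the uniform
distribution, in terms of the deviations of the unnormalized weights from one. -/
lemma sum_weight_mul_log_le [Nonempty ι] [DecidableEq ι] {om : ℝ}
    (hx : ∀ i, 0 < x i ∧ x i ≤ om) :
    ∑ i, (x i / ∑ j, x j) * Real.log (Fintype.card ι * (x i / ∑ j, x j)) ≤
      (∑ i, x i * Real.log (x i)) / Fintype.card ι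
      - (∑ i, (x i * Real.log (x i)) * (x i - 1)) / (Fintype.card ι : ℝ) ^ 2
      - (∑ i, (x i * Real.log (x i)) * ∑ j ∈ Finset.univ.erase i, (x j - 1))
          / (Fintype.card ι : ℝ) ^ 2
      + Real.log om * (∑ i, (x i - 1)) ^ 2 / (Fintype.card ι : ℝ) ^ 2
      - (∑ i, (x i - 1)) / Fintype.card ι
      + 2 * (∑ i, (x i)⁻¹ * (x i - 1) ^ 2) / (Fintype.card ι : ℝ) ^ 3
      + 2 * (∑ i, (x i)⁻¹ * (∑ j ∈ Finset.univ.erase i, (x j - 1)) ^ 2)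
          / (Fintype.card ι : ℝ) ^ 3 := by
  have hpos i := (hx i).1
  have hS : 0 < ∑ j, x j := Finset.sum_pos (fun i _ => hpos i) Finset.univ_nonempty
  have hinv := inv_mean_le_mean_inv hpos
  have hn : (0 : ℝ) < Fintype.card ι := by exact_mod_cast Fintype.card_pos
  have hT : ∑ i, (x i - 1) = (∑ i, x i) - Fintype.card ι := by
    simp [Finset.sum_sub_distrib]
  have hT_split i : ∑ j ∈ Finset.univ.erase i, (x j - 1) = ∑ j, (x j - 1) - (x i - 1) := by
    rw [← Finset.add_sum_erase Finset.univ _ (Finset.mem_univ i)]; ring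
  have hV : ∑ i, x i * Real.log (x i) ≤ Real.log om * ∑ i, x i := by
    rw [Finset.mul_sum]
    refine Finset.sum_le_sum fun i _ => ?_
    rw [mul_comm]
    exact mul_le_mul_of_nonneg_right (Real.log_le_log (hpos i) (hx i).2) (hpos i).le
  have hcross : ∑ i, (x i * Real.log (x i)) * (x i - 1)
      + ∑ i, (x i * Real.log (x i)) * ∑ j ∈ Finset.univ.erase i, (x j - 1)
      = (∑ i, x i * Real.log (x i)) * ∑ j, (x j - 1) := by
    rw [← Finset.sum_add_distrib, Finset.sum_mul]
    refine Finset.sum_congr rfl fun i _ => ?_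
    rw [hT_split]; ring
  have hsq : (∑ i, (x i)⁻¹) * (∑ j, (x j - 1)) ^ 2 ≤ 2 * (∑ i, (x i)⁻¹ * (x i - 1) ^ 2)
      + 2 * (∑ i, (x i)⁻¹ * (∑ j ∈ Finset.univ.erase i, (x j - 1)) ^ 2) := by
    rw [Finset.sum_mul, Finset.mul_sum, Finset.mul_sum, ← Finset.sum_add_distrib]
    refine Finset.sum_le_sum fun i _ => ?_
    rw [hT_split]
    have := inv_pos.2 (hpos i)
    nlinarith [mul_nonneg this.le (sq_nonneg (∑ j, (x j - 1) - 2 * (x i - 1)))]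
  have hlhs : ∑ i, (x i / ∑ j, x j) * Real.log (Fintype.card ι * (x i / ∑ j, x j))
      = (∑ i, x i * Real.log (x i)) / (∑ j, x j)
        - Real.log ((∑ i, x i) / Fintype.card ι) := by
    have : ∀ i, (x i / ∑ j, x j) * Real.log (Fintype.card ι * (x i / ∑ j, x j))
        = x i * Real.log (x i) / (∑ j, x j)
          - (x i / ∑ j, x j) * Real.log ((∑ i, x i) / Fintype.card ι) := fun i => by
      have e : Fintype.card ι * (x i / ∑ j, x j) = x i / ((∑ i, x i) / Fintype.card ι) := by
        field_simp
      rw [e, Real.log_div (hpos i).ne' (div_pos hS hn).ne']; ring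
    simp_rw [this]
    rw [Finset.sum_sub_distrib, ← Finset.sum_div, ← Finset.sum_mul, ← Finset.sum_div,
      div_self hS.ne', one_mul]
  rw [hlhs]
  generalize (∑ i, (x i * Real.log (x i)) * (x i - 1)) = c₁ at *
  generalize (∑ i, (x i * Real.log (x i)) * ∑ j ∈ Finset.univ.erase i, (x j - 1)) = c₂ at *
  generalize (∑ i, (x i)⁻¹ * (∑ j ∈ Finset.univ.erase i, (x j - 1)) ^ 2) = e₂ at *
  generalize (∑ i, (x i)⁻¹ * (x i - 1) ^ 2) = e₁ at *
  generalize (∑ i, x i * Real.log (x i)) = v at *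
  generalize (∑ i, (x i)⁻¹) = w at *
  rw [hT] at hcross hsq ⊢
  generalize (Fintype.card ι : ℝ) = n at *
  generalize (∑ i, x i) = S at *
  obtain ⟨m, rfl⟩ : ∃ m, S = n * m := ⟨S / n, by field_simp⟩
  have hm0 : 0 < m := pos_of_mul_pos_right hS hn.le
  have e1 : n * m / n = m := by field_simp
  rw [e1] at hinv ⊢
  have hlog := Real.one_sub_inv_le_log_of_pos hm0
  have b1 : v / (n * m) ≤ v / n - v * (n * m - n) / n ^ 2
      + Real.log om * (n * m - n) ^ 2 / n ^ 2 := by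
    have : v / n - v * (n * m - n) / n ^ 2 + Real.log om * (n * m - n) ^ 2 / n ^ 2 - v / (n * m)
        = (Real.log om * (n * m) - v) * ((m - 1) ^ 2 / (n * m)) := by
      field_simp; ring
    have h2 : 0 ≤ (Real.log om * (n * m) - v) * ((m - 1) ^ 2 / (n * m)) :=
      mul_nonneg (by linarith) (by positivity)
    linarith
  have b2 : m⁻¹ - 1 ≤ - (n * m - n) / n + (w * (n * m - n) ^ 2) / n ^ 3 := by
    have : - (n * m - n) / n + (w * (n * m - n) ^ 2) / n ^ 3 - (m⁻¹ - 1)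
        = (w / n - m⁻¹) * (m - 1) ^ 2 := by
      field_simp; ring
    have h2 : 0 ≤ (w / n - m⁻¹) * (m - 1) ^ 2 :=
      mul_nonneg (by linarith) (by positivity)
    linarith
  have b3 : (w * (n * m - n) ^ 2) / n ^ 3 ≤ (2 * e₁ + 2 * e₂) / n ^ 3 := by gcongr
  rw [← hcross] at b1
  simp only [add_div, neg_div] at *
  linarith

end Pointwise

section Product

variable {ι 𝒴 : Type*} [Fintype ι] [MeasurableSpace 𝒴] {P : Measure 𝒴} [IsProbabilityMeasure P]
  {g h : 𝒴 → ℝ}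

/-- Under a product measure, a function of one coordinate is independent of a sum over other
coordinates. -/
lemma indepFun_pi_eval_sum [DecidableEq ι] (hg : Measurable g) (hh : Measurable h) {s : Finset ι}
    {i : ι} (hi : i ∉ s) :
    IndepFun (fun y : ι → 𝒴 => h (y i)) (fun y => ∑ j ∈ s, g (y j)) (Measure.pi fun _ => P) := by
  let X : ι → 𝒴 → ℝ := fun j => if j = i then h else g
  have hX j : Measurable (X j) := by
    by_cases hj : j = i <;> simp [X, hj, hg, hh]
  have hind := iIndepFun_pi (μ := fun _ : ι => P) (X := X) fun j => (hX j).aemeasurable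
  have key := (hind.indepFun_finsetSum_of_notMem
    (fun j => (hX j).comp (measurable_pi_apply j)) hi).symm
  convert key using 1
  · simp [X]
  · ext y
    rw [Finset.sum_apply]
    refine Finset.sum_congr rfl fun j hj => ?_
    have : j ≠ i := fun e => hi (e ▸ hj)
    simp [X, this]

/-- The second moment of a sum of centered independent coordinates. -/
lemma integral_sq_sum_eval [DecidableEq ι] (hg : Measurable g) (hg2 : MemLp g 2 P)
    (hg0 : ∫ y, g y ∂P = 0) (s : Finset ι) :
    ∫ y : ι → 𝒴, (∑ j ∈ s, g (y j)) ^ 2 ∂(Measure.pi fun _ => P) = s.card * ∫ y, g y ^ 2 ∂P := by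
  have hL2 j : MemLp (fun y : ι → 𝒴 => g (y j)) 2 (Measure.pi fun _ => P) :=
    hg2.comp_measurePreserving (measurePreserving_eval _ j)
  induction s using Finset.induction_on with
  | empty => simp
  | insert i s hi ih =>
    have hs : MemLp (fun y : ι → 𝒴 => ∑ j ∈ s, g (y j)) 2 (Measure.pi fun _ => P) :=
      memLp_finsetSum s fun j _ => hL2 j
    have hcross : ∫ y : ι → 𝒴, g (y i) * ∑ j ∈ s, g (y j) ∂(Measure.pi fun _ => P) = 0 := by
      rw [(indepFun_pi_eval_sum hg hg hi).integral_fun_mul_eq_mul_integral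
        (hL2 i).aestronglyMeasurable hs.aestronglyMeasurable,
        integral_comp_eval (μ := fun _ : ι => P) hg.aestronglyMeasurable, hg0, zero_mul]
    have hexp : ∀ y : ι → 𝒴, (∑ j ∈ insert i s, g (y j)) ^ 2
        = g (y i) ^ 2 + 2 * (g (y i) * ∑ j ∈ s, g (y j)) + (∑ j ∈ s, g (y j)) ^ 2 := fun y => by
      rw [Finset.sum_insert hi]; ring
    have hi1 : Integrable (fun y : ι → 𝒴 => g (y i) * ∑ j ∈ s, g (y j)) (Measure.pi fun _ => P) :=
      (hL2 i).integrable_mul hs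
    have hi2 : Integrable (fun y : ι → 𝒴 => g (y i) ^ 2 + 2 * (g (y i) * ∑ j ∈ s, g (y j)))
        (Measure.pi fun _ => P) := (hL2 i).integrable_sq.add (hi1.const_mul 2)
    simp_rw [hexp]
    rw [integral_add hi2 hs.integrable_sq,
      integral_add (hL2 i).integrable_sq (hi1.const_mul 2), integral_const_mul, hcross, ih,
      integral_comp_eval (μ := fun _ : ι => P) (f := fun z => g z ^ 2)
        (hg.pow_const 2).aestronglyMeasurable, Finset.card_insert_of_notMem hi]
    push_cast
    ring

/-- The expected relative entropy (in nats) of self-normalized importance weights to the uniform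
distribution exceeds the relative entropy of the target by at most `O(1 / N)`. -/
theorem integral_sum_weight_mul_log_le [Nonempty ι] {om : ℝ} {r : 𝒴 → ℝ} (hrm : Measurable r)
    (hr1 : ∫ y, r y ∂P = 1) (hr : ∀ᵐ y ∂P, 0 < r y ∧ r y ≤ om)
    (hd2 : Integrable (fun y => (r y)⁻¹) P) :
    ∫ y : ι → 𝒴, (∑ i, (r (y i) / ∑ j, r (y j)) *
        Real.log (Fintype.card ι * (r (y i) / ∑ j, r (y j)))) ∂(Measure.pi fun _ => P)
      ≤ ∫ y, r y * Real.log (r y) ∂P + (om - 1) * Real.log om / Fintype.card ι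
        + 2 * om * (∫ y, (r y)⁻¹ ∂P) / Fintype.card ι := by
  classical
  set μ : Measure (ι → 𝒴) := Measure.pi fun _ => P
  have hn : (0 : ℝ) < Fintype.card ι := by exact_mod_cast Fintype.card_pos
  have hlm : Measurable fun y => r y * Real.log (r y) := by fun_prop
  have hZm : Measurable fun y => r y - 1 := by fun_prop
  have hUm : Measurable fun y => (r y)⁻¹ := by fun_prop
  have hr_int : Integrable r P := by
    refine Integrable.of_bound hrm.aestronglyMeasurable om ?_
    filter_upwards [hr] with y hy
    rw [Real.norm_of_nonneg hy.1.le]; exact hy.2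
  have hL2 : MemLp (fun y => r y * Real.log (r y)) 2 P := by
    refine MemLp.of_bound hlm.aestronglyMeasurable (om * |Real.log om| + 1) ?_
    filter_upwards [hr] with y hy
    have hom : 0 ≤ om := hy.1.le.trans hy.2
    rw [Real.norm_eq_abs, abs_le]
    constructor
    · have h := mul_le_mul_of_nonneg_left (Real.one_sub_inv_le_log_of_pos hy.1) hy.1.le
      rw [mul_sub, mul_inv_cancel₀ hy.1.ne'] at h
      have := mul_nonneg hom (abs_nonneg (Real.log om))
      linarith [hy.1]
    · have h := mul_le_mul hy.2 ((Real.log_le_log hy.1 hy.2).trans (le_abs_self _))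
      by_cases h0 : 0 ≤ Real.log (r y)
      · linarith [h h0 hom]
      · have := mul_nonneg hom (abs_nonneg (Real.log om))
        nlinarith [hy.1]
  have hZ2 : MemLp (fun y => r y - 1) 2 P := by
    refine MemLp.of_bound hZm.aestronglyMeasurable (om + 1) ?_
    filter_upwards [hr] with y hy
    rw [Real.norm_eq_abs, abs_le]
    constructor <;> linarith [hy.1, hy.2]
  have hZ0 : ∫ y, (r y - 1) ∂P = 0 := by
    rw [integral_sub hr_int (integrable_const 1), hr1]; simp
  have hZvar : ∫ y, (r y - 1) ^ 2 ∂P ≤ om - 1 := by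
    calc ∫ y, (r y - 1) ^ 2 ∂P ≤ ∫ y, ((om - 2) * r y + 1) ∂P := by
          refine integral_mono_ae hZ2.integrable_sq
            ((hr_int.const_mul _).add (integrable_const 1)) ?_
          filter_upwards [hr] with y hy
          nlinarith [mul_nonneg hy.1.le (sub_nonneg.2 hy.2)]
      _ = om - 1 := by
          rw [integral_add (hr_int.const_mul _) (integrable_const 1), integral_const_mul, hr1]
          simp; ring
  have hom1 : 1 ≤ om := by
    have : 0 ≤ ∫ y, (r y - 1) ^ 2 ∂P := integral_nonneg fun y => sq_nonneg _
    linarith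
  have hLZ : 0 ≤ ∫ y, (r y * Real.log (r y)) * (r y - 1) ∂P := by
    refine integral_nonneg_of_ae ?_
    filter_upwards [hr] with y hy
    have h : 0 ≤ Real.log (r y) * (r y - 1) := by
      rcases le_total 1 (r y) with h1 | h1
      · exact mul_nonneg (Real.log_nonneg h1) (by linarith)
      · exact mul_nonneg_of_nonpos_of_nonpos (Real.log_nonpos hy.1.le h1) (by linarith)
    simpa [mul_assoc] using mul_nonneg hy.1.le h
  have hUZ_eq : (fun y => (r y)⁻¹ * (r y - 1) ^ 2) =ᵐ[P] fun y => r y - 2 + (r y)⁻¹ := by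
    filter_upwards [hr] with y hy
    have := hy.1.ne'
    field_simp; ring
  have hr2_int : Integrable (fun y => r y - 2) P := hr_int.sub (integrable_const 2)
  have hUZ_int : Integrable (fun y => (r y)⁻¹ * (r y - 1) ^ 2) P :=
    (hr2_int.add hd2).congr hUZ_eq.symm
  have hUZ : ∫ y, (r y)⁻¹ * (r y - 1) ^ 2 ∂P = (∫ y, (r y)⁻¹ ∂P) - 1 := by
    rw [integral_congr_ae hUZ_eq, integral_add hr2_int hd2,
      integral_sub hr_int (integrable_const 2), hr1]
    simp; ring
  have hd2_nonneg : 0 ≤ ∫ y, (r y)⁻¹ ∂P := by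
    refine integral_nonneg_of_ae ?_
    filter_upwards [hr] with y hy using (inv_pos.2 hy.1).le
  have hZi j : MemLp (fun y : ι → 𝒴 => r (y j) - 1) 2 μ :=
    hZ2.comp_measurePreserving (measurePreserving_eval _ j)
  have hLi j : MemLp (fun y : ι → 𝒴 => r (y j) * Real.log (r (y j))) 2 μ :=
    hL2.comp_measurePreserving (measurePreserving_eval _ j)
  have hB (s : Finset ι) : MemLp (fun y : ι → 𝒴 => ∑ j ∈ s, (r (y j) - 1)) 2 μ :=
    memLp_finsetSum s fun j _ => hZi j
  have hUi i : Integrable (fun y : ι → 𝒴 => (r (y i))⁻¹) μ :=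
    integrable_comp_eval (μ := fun _ : ι => P) (f := fun z => (r z)⁻¹) hd2
  have hUB_ind i : IndepFun (fun y : ι → 𝒴 => (r (y i))⁻¹)
      (fun y => (∑ j ∈ Finset.univ.erase i, (r (y j) - 1)) ^ 2) μ :=
    (indepFun_pi_eval_sum hZm hUm (Finset.notMem_erase i Finset.univ)).comp measurable_id
      (measurable_id.pow_const 2)
  have hLZ_int i : Integrable (fun y : ι → 𝒴 =>
      (r (y i) * Real.log (r (y i))) * (r (y i) - 1)) μ := (hLi i).integrable_mul (hZi i)
  have hLB_int i : Integrable (fun y : ι → 𝒴 => (r (y i) * Real.log (r (y i))) *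
      ∑ j ∈ Finset.univ.erase i, (r (y j) - 1)) μ := (hLi i).integrable_mul (hB _)
  have i₁ : Integrable (fun y : ι → 𝒴 => ∑ i, r (y i) * Real.log (r (y i))) μ :=
    integrable_finsetSum _ fun i _ => (hLi i).integrable one_le_two
  have i₂ : Integrable (fun y : ι → 𝒴 => ∑ i, (r (y i) * Real.log (r (y i))) * (r (y i) - 1)) μ :=
    integrable_finsetSum _ fun i _ => hLZ_int i
  have i₃ : Integrable (fun y : ι → 𝒴 => ∑ i, (r (y i) * Real.log (r (y i))) *
      ∑ j ∈ Finset.univ.erase i, (r (y j) - 1)) μ :=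
    integrable_finsetSum _ fun i _ => hLB_int i
  have i₄ : Integrable (fun y : ι → 𝒴 => (∑ i, (r (y i) - 1)) ^ 2) μ := (hB _).integrable_sq
  have i₅ : Integrable (fun y : ι → 𝒴 => ∑ i, (r (y i) - 1)) μ := (hB _).integrable one_le_two
  have i₆ : Integrable (fun y : ι → 𝒴 => ∑ i, (r (y i))⁻¹ * (r (y i) - 1) ^ 2) μ :=
    integrable_finsetSum _ fun i _ =>
      integrable_comp_eval (μ := fun _ : ι => P) (f := fun z => (r z)⁻¹ * (r z - 1) ^ 2) hUZ_int
  have hUB_int i : Integrable (fun y : ι → 𝒴 => (r (y i))⁻¹ *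
      (∑ j ∈ Finset.univ.erase i, (r (y j) - 1)) ^ 2) μ :=
    (hUB_ind i).integrable_mul (hUi i) (hB _).integrable_sq
  have i₇ : Integrable (fun y : ι → 𝒴 => ∑ i, (r (y i))⁻¹ *
      (∑ j ∈ Finset.univ.erase i, (r (y j) - 1)) ^ 2) μ :=
    integrable_finsetSum _ fun i _ => hUB_int i
  have e₁ : ∫ y, ∑ i, r (y i) * Real.log (r (y i)) ∂μ
      = Fintype.card ι * ∫ y, r y * Real.log (r y) ∂P := by
    rw [integral_finsetSum _ fun i _ => (hLi i).integrable one_le_two]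
    simp_rw [μ, integral_comp_eval (μ := fun _ : ι => P) (f := fun z => r z * Real.log (r z))
      hlm.aestronglyMeasurable]
    simp
  have e₂ : 0 ≤ ∫ y, ∑ i, (r (y i) * Real.log (r (y i))) * (r (y i) - 1) ∂μ := by
    rw [integral_finsetSum _ fun i _ => hLZ_int i]
    refine Finset.sum_nonneg fun i _ => ?_
    rw [integral_comp_eval (μ := fun _ : ι => P)
      (f := fun z => (r z * Real.log (r z)) * (r z - 1)) (hlm.mul hZm).aestronglyMeasurable]
    exact hLZ
  have e₅ (s : Finset ι) : ∫ y : ι → 𝒴, ∑ i ∈ s, (r (y i) - 1) ∂μ = 0 := by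
    rw [integral_finsetSum _ fun i _ => (hZi i).integrable one_le_two]
    refine Finset.sum_eq_zero fun i _ => ?_
    rw [integral_comp_eval (μ := fun _ : ι => P) (f := fun z => r z - 1)
      hZm.aestronglyMeasurable, hZ0]
  have e₃ : ∫ y, ∑ i, (r (y i) * Real.log (r (y i))) *
      ∑ j ∈ Finset.univ.erase i, (r (y j) - 1) ∂μ = 0 := by
    rw [integral_finsetSum _ fun i _ => hLB_int i]
    refine Finset.sum_eq_zero fun i _ => ?_
    rw [(indepFun_pi_eval_sum hZm hlm
      (Finset.notMem_erase i Finset.univ)).integral_fun_mul_eq_mul_integral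
      (hLi i).aestronglyMeasurable (hB _).aestronglyMeasurable, e₅, mul_zero]
  have e₄ : ∫ y : ι → 𝒴, (∑ i, (r (y i) - 1)) ^ 2 ∂μ ≤ Fintype.card ι * (om - 1) := by
    rw [integral_sq_sum_eval hZm hZ2 hZ0, Finset.card_univ]
    gcongr
  have e₆ : ∫ y : ι → 𝒴, ∑ i, (r (y i))⁻¹ * (r (y i) - 1) ^ 2 ∂μ
      = Fintype.card ι * ((∫ y, (r y)⁻¹ ∂P) - 1) := by
    rw [integral_finsetSum _ fun i _ =>
      integrable_comp_eval (μ := fun _ : ι => P) (f := fun z => (r z)⁻¹ * (r z - 1) ^ 2) hUZ_int]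
    rw [Finset.sum_congr rfl fun i _ => (integral_comp_eval (μ := fun _ : ι => P) (i := i)
      (f := fun z => (r z)⁻¹ * (r z - 1) ^ 2) hUZ_int.aestronglyMeasurable).trans hUZ]
    rw [Finset.sum_const, Finset.card_univ, nsmul_eq_mul]
  have e₇ : ∫ y : ι → 𝒴, ∑ i, (r (y i))⁻¹ *
      (∑ j ∈ Finset.univ.erase i, (r (y j) - 1)) ^ 2 ∂μ
      ≤ Fintype.card ι * ((∫ y, (r y)⁻¹ ∂P) * ((Fintype.card ι - 1) * (om - 1))) := by
    rw [integral_finsetSum _ fun i _ => hUB_int i, ← nsmul_eq_mul, ← Finset.card_univ]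
    refine Finset.sum_le_card_nsmul _ _ _ fun i _ => ?_
    rw [(hUB_ind i).integral_fun_mul_eq_mul_integral (hUi i).aestronglyMeasurable
      (hB _).integrable_sq.aestronglyMeasurable, integral_sq_sum_eval hZm hZ2 hZ0,
      integral_comp_eval (μ := fun _ : ι => P) (f := fun z => (r z)⁻¹) hUm.aestronglyMeasurable,
      Finset.card_erase_of_mem (Finset.mem_univ i), Finset.card_univ,
      Nat.cast_pred Fintype.card_pos]
    have : (0 : ℝ) ≤ Fintype.card ι - 1 := by
      rw [sub_nonneg]; exact_mod_cast Fintype.card_pos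
    gcongr
  have hae : ∀ᵐ y ∂μ, ∀ i, 0 < r (y i) ∧ r (y i) ≤ om :=
    ae_all_iff.2 fun i => (measurePreserving_eval (fun _ : ι => P) i).quasiMeasurePreserving.ae hr
  have j₁ := i₁.div_const (Fintype.card ι : ℝ)
  have j₂ := i₂.div_const ((Fintype.card ι : ℝ) ^ 2)
  have j₃ := i₃.div_const ((Fintype.card ι : ℝ) ^ 2)
  have j₄ := (i₄.const_mul (Real.log om)).div_const ((Fintype.card ι : ℝ) ^ 2)
  have j₅ := i₅.div_const (Fintype.card ι : ℝ)
  have j₆ := (i₆.const_mul 2).div_const ((Fintype.card ι : ℝ) ^ 3)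
  have j₇ := (i₇.const_mul 2).div_const ((Fintype.card ι : ℝ) ^ 3)
  have k₂ := j₁.sub j₂
  have k₃ := k₂.sub j₃
  have k₄ := k₃.add j₄
  have k₅ := k₄.sub j₅
  have k₆ := k₅.add j₆
  refine (integral_mono_of_nonneg ?_ (k₆.add j₇) ?_).trans ?_
  · filter_upwards [hae] with y hy using sum_weight_mul_log_nonneg fun i => (hy i).1
  · filter_upwards [hae] with y hy using sum_weight_mul_log_le hy
  · rw [integral_add' k₆ j₇, integral_add' k₅ j₆, integral_sub' k₄ j₅, integral_add' k₃ j₄,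
      integral_sub' k₂ j₃, integral_sub' j₁ j₂]
    simp only [integral_div, integral_const_mul]
    rw [e₁, e₃, e₅, e₆]
    have hlog : 0 ≤ Real.log om := Real.log_nonneg hom1
    have hn1 : (1 : ℝ) ≤ Fintype.card ι := by exact_mod_cast Fintype.card_pos
    generalize (∫ y, (r y)⁻¹ ∂P) = d at *
    generalize (Fintype.card ι : ℝ) = n at *
    have b₂ := div_nonneg e₂ (sq_nonneg n)
    have b₄ : Real.log om * (∫ y : ι → 𝒴, (∑ i, (r (y i) - 1)) ^ 2 ∂μ) / n ^ 2
        ≤ (om - 1) * Real.log om / n := by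
      calc _ ≤ Real.log om * (n * (om - 1)) / n ^ 2 := by gcongr
        _ = _ := by field_simp
    have b₇ : 2 * (∫ y : ι → 𝒴, ∑ i, (r (y i))⁻¹ *
        (∑ j ∈ Finset.univ.erase i, (r (y j) - 1)) ^ 2 ∂μ) / n ^ 3
        ≤ 2 * (n * (d * ((n - 1) * (om - 1)))) / n ^ 3 := by gcongr
    have b₈ : 2 * (n * (d - 1)) / n ^ 3 + 2 * (n * (d * ((n - 1) * (om - 1)))) / n ^ 3
        ≤ 2 * om * d / n := by
      have : 2 * om * d / n
          - (2 * (n * (d - 1)) / n ^ 3 + 2 * (n * (d * ((n - 1) * (om - 1)))) / n ^ 3)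
          = (2 + 2 * (d * (n - 1)) + 2 * (d * (om - 1))) / n ^ 2 := by
        field_simp; ring
      have : 0 ≤ (2 + 2 * (d * (n - 1)) + 2 * (d * (om - 1))) / n ^ 2 := by
        have := mul_nonneg hd2_nonneg (sub_nonneg.2 hn1)
        have := mul_nonneg hd2_nonneg (sub_nonneg.2 hom1)
        positivity
      linarith
    have b₁ : n * (∫ y, r y * Real.log (r y) ∂P) / n = ∫ y, r y * Real.log (r y) ∂P := by
      field_simp
    rw [b₁, zero_div, zero_div]
    linarith

end Product

/-- `Q ≪ P` with density `r = dQ/dP ∈ (0, ω]` `P`-a.e., and the moments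
`d₂(P‖Q) = E_P[1/r]`, `d₃(P‖Q) = E_P[1/r²]` are finite.  With `Y₁,…,Y_N` i.i.d. `P` and
self-normalized importance weights `λᵢ = r (Y i) / ∑ⱼ r (Y j)`,
`E[∑ᵢ λᵢ log₂ (N λᵢ)] ≤ D(Q‖P) + 6(ω−1)log₂ω/N + α/N`, where
`D(Q‖P) = E_P[r log₂ r]` and
`α = 2(ω−1) + 2√(ω−1)⬝(d₃(P‖Q) − d₂(P‖Q)²)^{1/2} + 4ω⬝d₂(P‖Q)`. -/
theorem stmt8
    {𝒴 : Type*} [MeasurableSpace 𝒴] (P Q : Measure 𝒴)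
    [IsProbabilityMeasure P] [IsProbabilityMeasure Q]
    (om : ℝ) (r : 𝒴 → ℝ) (hrm : Measurable r)
    (hQ : Q = P.withDensity (fun y => ENNReal.ofReal (r y)))
    (hr : ∀ᵐ y ∂P, 0 < r y ∧ r y ≤ om)
    (hd2 : Integrable (fun y => (r y)⁻¹) P)
    (hd3 : Integrable (fun y => ((r y)⁻¹) ^ 2) P)
    (N : ℕ) (hN : 0 < N) :
    ∫ y : Fin N → 𝒴,
        (∑ i, (r (y i) / ∑ j, r (y j)) *
          Real.logb 2 ((N : ℝ) * (r (y i) / ∑ j, r (y j))))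
        ∂(Measure.pi fun _ : Fin N => P)
      ≤ (∫ y, r y * Real.logb 2 (r y) ∂P)
        + 6 * (om - 1) * Real.logb 2 om / N
        + (2 * (om - 1)
            + 2 * Real.sqrt (om - 1) *
                Real.sqrt ((∫ y, ((r y)⁻¹) ^ 2 ∂P) - (∫ y, (r y)⁻¹ ∂P) ^ 2)
            + 4 * om * ∫ y, (r y)⁻¹ ∂P) / N := by
  have hr1 : ∫ y, r y ∂P = 1 := by
    have h : Q Set.univ = 1 := measure_univ
    rw [hQ, withDensity_apply _ MeasurableSet.univ, Measure.restrict_univ] at h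
    rw [integral_eq_lintegral_of_nonneg_ae (hr.mono fun y hy => hy.1.le)
      hrm.aestronglyMeasurable, h, ENNReal.toReal_one]
  have hom1 : 1 ≤ om := by
    rw [← hr1]
    refine (integral_mono_ae (integrable_of_integral_eq_one hr1) (integrable_const om)
      (hr.mono fun y hy => hy.2)).trans_eq (by simp)
  have hd2_nonneg : 0 ≤ ∫ y, (r y)⁻¹ ∂P :=
    integral_nonneg_of_ae (hr.mono fun y hy => (inv_pos.2 hy.1).le)
  have : Nonempty (Fin N) := ⟨⟨0, hN⟩⟩
  have hn : (0 : ℝ) < N := by exact_mod_cast hN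
  have hlog2 : 1 / 2 < Real.log 2 := by linarith [Real.log_two_gt_d9]
  have hlog2_pos : 0 < Real.log 2 := by linarith
  have main := integral_sum_weight_mul_log_le (ι := Fin N) hrm hr1 hr hd2
  rw [Fintype.card_fin] at main
  simp only [Real.logb, ← mul_div_assoc, ← Finset.sum_div, integral_div]
  simp only [← mul_div_assoc] at main
  have hlog := Real.log_nonneg hom1
  refine (div_le_div_of_nonneg_right main hlog2_pos.le).trans ?_
  rw [add_div, add_div]
  generalize (∫ y, (r y)⁻¹ ∂P) = d at *
  have b₁ : (om - 1) * Real.log om / N / Real.log 2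
      ≤ 6 * (om - 1) * Real.log om / Real.log 2 / N := by
    rw [div_right_comm]
    have := mul_nonneg (sub_nonneg.2 hom1) hlog
    gcongr
    nlinarith
  have b₂ : 2 * om * d / N / Real.log 2 ≤ (2 * (om - 1)
      + 2 * Real.sqrt (om - 1) * Real.sqrt ((∫ y, ((r y)⁻¹) ^ 2 ∂P) - d ^ 2) + 4 * om * d) / N := by
    rw [div_right_comm]
    gcongr
    have hod : 0 ≤ om * d := mul_nonneg (by linarith) hd2_nonneg
    calc 2 * om * d / Real.log 2 ≤ 4 * om * d := by
          rw [div_le_iff₀ hlog2_pos]; nlinarith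
      _ ≤ _ := by
          have : 0 ≤ 2 * (om - 1) := by linarith
          have : 0 ≤ 2 * Real.sqrt (om - 1) *
            Real.sqrt ((∫ y, ((r y)⁻¹) ^ 2 ∂P) - d ^ 2) := by positivity
          linarith
  linarith
end

section
/- Let P and Q be probability measures on a measurable space 𝒴 with Q ≪ P and P ≪ Q, with density r = dQ/dP strictly positive, and assume d₂(Q‖P) = E_{Y∼P}[r(Y)²], d₂(P‖Q) = E_{Y∼P}[1/r(Y)], and d₃(P‖Q) = E_{Y∼P}[1/r(Y)²] are finite. Let Y_1,…,Y_N be i.i.d. with law P. Then E[ N / Σ_{i=1}^N r(Y_i) ] ≤ 1 + (2(d₂(Q‖P)−1) + 2((d₃(P‖Q) − d₂(P‖Q)²)(d₂(Q‖P)−1))^{1/2} + 4(d₂(Q‖P)−1)·d₂(P‖Q))/N. -/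
open MeasureTheory ProbabilityTheory

/-- Three coordinate factors, written as a product over all coordinates. -/
lemma mul_mul_eval_eq_prod {α ι : Type*} [Fintype ι] [DecidableEq ι] (u w : α → ℝ)
    (i j k : ι) (y : ι → α) :
    u (y i) * u (y j) * w (y k) =
      ∏ l, (if l = i then u (y l) else 1) * (if l = j then u (y l) else 1) *
        (if l = k then w (y l) else 1) := by
  rw [Finset.prod_mul_distrib, Finset.prod_mul_distrib]
  simp only [Finset.prod_ite_eq', Finset.mem_univ, if_true]

section ProductMoments

variable {α ι : Type*} [MeasurableSpace α] {P : Measure α} [IsProbabilityMeasure P]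
  [Fintype ι] [DecidableEq ι] {u w : α → ℝ}

lemma integrable_pi_mul_mul_eval (hu : Integrable u P) (hw : Integrable w P)
    (huu : Integrable (fun a => u a * u a) P) (huw : Integrable (fun a => u a * w a) P)
    (huuw : Integrable (fun a => u a * u a * w a) P) (i j k : ι) :
    Integrable (fun y : ι → α => u (y i) * u (y j) * w (y k)) (Measure.pi fun _ => P) := by
  simp_rw [mul_mul_eval_eq_prod]
  refine Integrable.fintype_prod (f := fun l a => (if l = i then u a else 1) *
    (if l = j then u a else 1) * (if l = k then w a else 1)) fun l => ?_
  split_ifs <;> (try simp only [one_mul, mul_one]) <;> first | assumption | fun_prop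

/-- Mixed moments of a centred `u` and a weight `w` under independent coordinates. -/
lemma integral_pi_mul_mul_eval (hu : ∫ a, u a ∂P = 0) (i j k : ι) :
    ∫ y : ι → α, u (y i) * u (y j) * w (y k) ∂(Measure.pi fun _ => P) =
      if i = j then
        if i = k then ∫ a, u a * u a * w a ∂P else (∫ a, u a * u a ∂P) * ∫ a, w a ∂P
      else 0 := by
  simp_rw [mul_mul_eval_eq_prod]
  rw [integral_fintype_prod_eq_prod (fun l a => (if l = i then u a else 1) *
    (if l = j then u a else 1) * (if l = k then w a else 1))]
  split_ifs with hij hik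
  · subst hij hik
    rw [Finset.prod_eq_single i (fun l _ hl => by simp [hl]) (by simp)]
    simp
  · subst hij
    have h (l : ι) : ∫ a, (if l = i then u a else 1) * (if l = i then u a else 1) *
        (if l = k then w a else 1) ∂P =
        (if l = i then ∫ a, u a * u a ∂P else 1) * (if l = k then ∫ a, w a ∂P else 1) := by
      by_cases hi : l = i
      · simp [hi, hik]
      · by_cases hk : l = k <;> simp [hi, hk, Ne.symm hik]
    simp_rw [h]
    rw [Finset.prod_mul_distrib]
    simp
  · by_cases hik : i = k
    · refine Finset.prod_eq_zero (Finset.mem_univ j) ?_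
      have hjk : j ≠ k := fun h => hij (hik.trans h.symm)
      simp [Ne.symm hij, hjk, hu]
    · refine Finset.prod_eq_zero (Finset.mem_univ i) ?_
      simp [hij, hik, hu]

lemma integral_pi_sq_sum_mul_sum (hu : Integrable u P) (hw : Integrable w P)
    (huu : Integrable (fun a => u a * u a) P) (huw : Integrable (fun a => u a * w a) P)
    (huuw : Integrable (fun a => u a * u a * w a) P) (hu0 : ∫ a, u a ∂P = 0) :
    Integrable (fun y : ι → α => (∑ i, u (y i)) ^ 2 * ∑ k, w (y k)) (Measure.pi fun _ => P) ∧
    ∫ y : ι → α, (∑ i, u (y i)) ^ 2 * ∑ k, w (y k) ∂(Measure.pi fun _ => P) =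
      Fintype.card ι * ((∫ a, u a * u a * w a ∂P) +
        (Fintype.card ι - 1) * ((∫ a, u a * u a ∂P) * ∫ a, w a ∂P)) := by
  have hint := integrable_pi_mul_mul_eval (ι := ι) hu hw huu huw huuw
  have hexp (y : ι → α) : (∑ i, u (y i)) ^ 2 * ∑ k, w (y k) =
      ∑ i, ∑ j, ∑ k, u (y i) * u (y j) * w (y k) := by
    rw [sq, Finset.sum_mul_sum, Finset.sum_mul]
    simp_rw [Finset.sum_mul_sum]
  simp_rw [hexp]
  refine ⟨integrable_finsetSum _ fun i _ => integrable_finsetSum _ fun j _ =>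
    integrable_finsetSum _ fun k _ => hint i j k, ?_⟩
  rw [integral_finsetSum _ fun i _ => integrable_finsetSum _ fun j _ =>
    integrable_finsetSum _ fun k _ => hint i j k]
  have h (i : ι) : ∫ y : ι → α, ∑ j, ∑ k, u (y i) * u (y j) * w (y k) ∂(Measure.pi fun _ => P) =
      (∫ a, u a * u a * w a ∂P) +
        (Fintype.card ι - 1) * ((∫ a, u a * u a ∂P) * ∫ a, w a ∂P) := by
    rw [integral_finsetSum _ fun j _ => integrable_finsetSum _ fun k _ => hint i j k]
    simp_rw [integral_finsetSum _ fun k _ => hint i _ k, integral_pi_mul_mul_eval hu0]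
    rw [Finset.sum_eq_single i (fun j _ hj => by simp [Ne.symm hj]) (by simp)]
    simp only [if_true]
    rw [← Finset.add_sum_erase _ _ (Finset.mem_univ i),
      Finset.sum_congr rfl fun k hk => if_neg (Finset.ne_of_mem_erase hk).symm]
    have hcard : 1 ≤ Fintype.card ι := Fintype.card_pos_iff.2 ⟨i⟩
    simp [Finset.card_erase_of_mem, Nat.cast_sub hcard]
  simp_rw [h]
  rw [Finset.sum_const, Finset.card_univ, nsmul_eq_mul]

end ProductMoments

/-- Second-order bound on the reciprocal of a mean, with the remainder controlled by the
arithmetic-harmonic mean inequality. -/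
lemma card_div_sum_le {ι : Type*} [Fintype ι] [Nonempty ι] (x : ι → ℝ) (hx : ∀ i, 0 < x i) :
    (Fintype.card ι : ℝ) / ∑ i, x i ≤ 1 - (∑ i, (x i - 1)) / Fintype.card ι +
      ((∑ i, (x i - 1)) ^ 2 * ∑ i, (x i)⁻¹) / (Fintype.card ι : ℝ) ^ 3 := by
  have hT : 0 < ∑ i, x i := Finset.sum_pos (fun i _ => hx i) Finset.univ_nonempty
  have hn : (0 : ℝ) < Fintype.card ι := by exact_mod_cast Fintype.card_pos
  have hharm := Finset.sq_sum_div_le_sum_sq_div Finset.univ (fun _ => (1 : ℝ)) fun i _ => hx i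
  simp only [Finset.sum_const, Finset.card_univ, nsmul_eq_mul, mul_one, one_pow, one_div] at hharm
  rw [Finset.sum_sub_distrib]
  simp only [Finset.sum_const, Finset.card_univ, nsmul_eq_mul, mul_one]
  generalize (∑ i, x i) = T at *
  generalize (Fintype.card ι : ℝ) = n at *
  calc n / T = 1 - (T - n) / n + (T - n) ^ 2 * (n ^ 2 / T) / n ^ 3 := by field_simp; ring
    _ ≤ _ := by gcongr

/-- The covariance inequality for `r` and `r⁻¹`, where `r` has mean one. -/
lemma sq_integral_inv_sub_one_le {α : Type*} [MeasurableSpace α] {P : Measure α}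
    [IsProbabilityMeasure P] {r : α → ℝ} (hr_pos : ∀ a, 0 < r a) (hr : Integrable r P)
    (hr1 : ∫ a, r a ∂P = 1) (hr2 : Integrable (fun a => r a ^ 2) P)
    (hinv : Integrable (fun a => (r a)⁻¹) P) (hinv2 : Integrable (fun a => (r a)⁻¹ ^ 2) P) :
    ((∫ a, (r a)⁻¹ ∂P) - 1) ^ 2 ≤
      ((∫ a, (r a)⁻¹ ^ 2 ∂P) - (∫ a, (r a)⁻¹ ∂P) ^ 2) * ((∫ a, r a ^ 2 ∂P) - 1) := by
  set m := ∫ a, (r a)⁻¹ ∂P with hm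
  have hquad (t : ℝ) : 0 ≤ ((∫ a, r a ^ 2 ∂P) - 1) * (t * t) + (-2 * (m - 1)) * t +
      ((∫ a, (r a)⁻¹ ^ 2 ∂P) - m ^ 2) := by
    have h0 : 0 ≤ ∫ a, (t * (r a - 1) + ((r a)⁻¹ - m)) ^ 2 ∂P :=
      integral_nonneg fun a => sq_nonneg _
    have hexp (a : α) : (t * (r a - 1) + ((r a)⁻¹ - m)) ^ 2 =
        t ^ 2 * r a ^ 2 + (r a)⁻¹ ^ 2 + (-2 * t ^ 2 - 2 * t * m) * r a +
          (-2 * t - 2 * m) * (r a)⁻¹ + (t ^ 2 + 2 * t + 2 * t * m + m ^ 2) := by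
      have := (hr_pos a).ne'
      field_simp
      ring
    simp_rw [hexp] at h0
    rw [integral_add (by fun_prop) (by fun_prop), integral_add (by fun_prop) (by fun_prop),
      integral_add (by fun_prop) (by fun_prop), integral_add (by fun_prop) (by fun_prop),
      integral_const_mul, integral_const_mul, integral_const_mul, hr1, ← hm] at h0
    simp only [integral_const, probReal_univ, smul_eq_mul, one_mul] at h0
    linarith
  have := discrim_le_zero hquad
  rw [discrim] at this
  linarith

/-- `Q ≪ P` and `P ≪ Q` with strictly positive density `r = dQ/dP`,
and finite moments `d₂(Q‖P) = E_P[r²]`, `d₂(P‖Q) = E_P[1/r]`, `d₃(P‖Q) = E_P[1/r²]`.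
With `Y₁,…,Y_N` i.i.d. `P`,
`E[N/∑ᵢ r (Y i)] ≤ 1 + (2(d₂(Q‖P)−1) + 2((d₃(P‖Q) − d₂(P‖Q)²)(d₂(Q‖P)−1))^{1/2}
+ 4(d₂(Q‖P)−1)⬝d₂(P‖Q))/N`. -/
theorem stmt12
    {𝒴 : Type*} [MeasurableSpace 𝒴] (P Q : Measure 𝒴)
    [IsProbabilityMeasure P] [IsProbabilityMeasure Q]
    (r : 𝒴 → ℝ) (hrm : Measurable r) (hr_pos : ∀ y, 0 < r y)
    (hQ : Q = P.withDensity (fun y => ENNReal.ofReal (r y)))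
    (hd2Q : Integrable (fun y => (r y) ^ 2) P)
    (hd2P : Integrable (fun y => (r y)⁻¹) P)
    (hd3P : Integrable (fun y => ((r y)⁻¹) ^ 2) P)
    (N : ℕ) (hN : 0 < N) :
    ∫⁻ y : Fin N → 𝒴, ENNReal.ofReal ((N : ℝ) / ∑ i, r (y i))
        ∂(Measure.pi fun _ : Fin N => P)
      ≤ ENNReal.ofReal (1 +
          (2 * ((∫ y, (r y) ^ 2 ∂P) - 1)
            + 2 * Real.sqrt (((∫ y, ((r y)⁻¹) ^ 2 ∂P) - (∫ y, (r y)⁻¹ ∂P) ^ 2) *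
                ((∫ y, (r y) ^ 2 ∂P) - 1))
            + 4 * ((∫ y, (r y) ^ 2 ∂P) - 1) * ∫ y, (r y)⁻¹ ∂P) / N) := by
  have hN' : (0 : ℝ) < N := by exact_mod_cast hN
  have : Nonempty (Fin N) := ⟨⟨0, hN⟩⟩
  have hr : Integrable r P :=
    ((memLp_two_iff_integrable_sq hrm.aestronglyMeasurable).2 hd2Q).integrable one_le_two
  have hr1 : ∫ y, r y ∂P = 1 := by
    have h : ∫⁻ y, ENNReal.ofReal (r y) ∂P = 1 := by
      rw [← setLIntegral_univ, ← withDensity_apply _ MeasurableSet.univ, ← hQ, measure_univ]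
    rw [integral_eq_lintegral_of_nonneg_ae (.of_forall fun y => (hr_pos y).le)
      hrm.aestronglyMeasurable, h, ENNReal.toReal_one]
  have hcov := Real.le_sqrt_of_sq_le (sq_integral_inv_sub_one_le hr_pos hr hr1 hd2Q hd2P hd3P)
  have hm : 0 ≤ ∫ y, (r y)⁻¹ ∂P := integral_nonneg fun y => (inv_pos.2 (hr_pos y)).le
  have huu_eq (y : 𝒴) : (r y - 1) * (r y - 1) = r y ^ 2 - 2 * r y + 1 := by ring
  have huw_eq (y : 𝒴) : (r y - 1) * (r y)⁻¹ = 1 - (r y)⁻¹ := by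
    have := (hr_pos y).ne'
    field_simp
  have huuw_eq (y : 𝒴) : (r y - 1) * (r y - 1) * (r y)⁻¹ = r y - 2 + (r y)⁻¹ := by
    have := (hr_pos y).ne'
    field_simp
    ring
  have hu : Integrable (fun y => r y - 1) P := by fun_prop
  have hu0 : ∫ y, (r y - 1) ∂P = 0 := by
    rw [integral_sub hr (by fun_prop), hr1]
    simp
  have huu0 : ∫ y, (r y - 1) * (r y - 1) ∂P = (∫ y, r y ^ 2 ∂P) - 1 := by
    simp_rw [huu_eq]
    rw [integral_add (by fun_prop) (by fun_prop), integral_sub hd2Q (by fun_prop),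
      integral_const_mul, hr1]
    simp
    ring
  have huuw0 : ∫ y, (r y - 1) * (r y - 1) * (r y)⁻¹ ∂P = (∫ y, (r y)⁻¹ ∂P) - 1 := by
    simp_rw [huuw_eq]
    rw [integral_add (by fun_prop) hd2P, integral_sub hr (by fun_prop), hr1]
    simp
    ring
  have hvar : 0 ≤ (∫ y, r y ^ 2 ∂P) - 1 :=
    huu0 ▸ integral_nonneg fun y => mul_self_nonneg (r y - 1)
  obtain ⟨hI, hE⟩ := integral_pi_sq_sum_mul_sum (ι := Fin N) hu hd2P
    (by simp_rw [huu_eq]; fun_prop) (by simp_rw [huw_eq]; fun_prop)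
    (by simp_rw [huuw_eq]; fun_prop) hu0
  rw [huu0, huuw0, Fintype.card_fin] at hE
  have hui (i : Fin N) : Integrable (fun y : Fin N → 𝒴 => r (y i) - 1) (Measure.pi fun _ => P) :=
    integrable_comp_eval (μ := fun _ : Fin N => P) (i := i) hu
  have hS : Integrable (fun y : Fin N → 𝒴 => ∑ i, (r (y i) - 1)) (Measure.pi fun _ => P) :=
    integrable_finsetSum _ fun i _ => hui i
  have hS0 : ∫ y : Fin N → 𝒴, ∑ i, (r (y i) - 1) ∂(Measure.pi fun _ => P) = 0 := by
    rw [integral_finsetSum _ fun i _ => hui i]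
    refine Finset.sum_eq_zero fun i _ => ?_
    rw [integral_comp_eval (μ := fun _ : Fin N => P) (i := i) (f := fun a => r a - 1)
      hu.aestronglyMeasurable, hu0]
  have hle (y : Fin N → 𝒴) := card_div_sum_le (fun i => r (y i)) fun i => hr_pos (y i)
  simp only [Fintype.card_fin] at hle
  have hnn (y : Fin N → 𝒴) : 0 ≤ (N : ℝ) / ∑ i, r (y i) :=
    div_nonneg hN'.le (Finset.sum_nonneg fun i _ => (hr_pos (y i)).le)
  refine (lintegral_mono fun y => ENNReal.ofReal_le_ofReal (hle y)).trans ?_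
  rw [← ofReal_integral_eq_lintegral_ofReal (by fun_prop)
    (.of_forall fun y => (hnn y).trans (hle y))]
  refine ENNReal.ofReal_le_ofReal ?_
  rw [integral_add (by fun_prop) (by fun_prop),
    integral_sub (integrable_const _) (hS.div_const _), integral_div, integral_div, hS0, hE]
  simp only [integral_const, probReal_univ, smul_eq_mul, mul_one, zero_div, sub_zero]
  gcongr 1 + ?_
  rw [div_le_div_iff₀ (by positivity) hN']
  generalize (∫ y, (r y)⁻¹ ∂P) = m at *
  generalize (∫ y, r y ^ 2 ∂P) - 1 = v at *
  have hN1 : (1 : ℝ) ≤ N := by exact_mod_cast hN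
  have hvm : 0 ≤ v * m := mul_nonneg hvar hm
  generalize hs_def : √(_ * v) = s at *
  have hs : 0 ≤ s := hs_def ▸ Real.sqrt_nonneg _
  have hbound : m - 1 + (N - 1) * (v * m) ≤ N * (2 * v + 2 * s + 4 * v * m) := by nlinarith
  nlinarith [mul_le_mul_of_nonneg_left hbound (sq_nonneg (N : ℝ))]
end
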